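/- arXiv:1701.04017 — 2 statements merged into one kernel-verified Lean document; each statement's English description precedes it below -/
import Mathlib

section
/- Consider the planar singularly perturbed impulsive system μ x₁' = −x₁ + x₂, μ x₂' = −x₁ − x₂ with impulse conditions μ Δx₁|_{t=θ_i} = −2μ x₁ and μ Δx₂|_{t=θ_i} = μ sin(x₂^{1/3} + μ) at the moments θ_i = i/3, i = 1,…,10, on the interval [0,T] with T = 4, where x₂^{1/3} denotes the real (sign-preserving) cube root. Then for every initial value (a,b) ∈ ℝ² (which lies in the domain of attraction of the root (0,0) of the reduced equations), the solution (x₁(t,μ), x₂(t,μ)) with (x₁(0,μ), x₂(0,μ)) = (a,b) exists on [0,T] for all sufficiently small μ > 0 and satisfies lim_{μ→0+} (x₁(t,μ), x₂(t,μ)) = (0,0) for every t ∈ (0,T]. -/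
open Filter Topology Set

noncomputable section

/-- The real (sign-preserving) cube root. -/
def cbrt (x : ℝ) : ℝ := Real.sign x * |x| ^ ((1:ℝ)/3)

/-- `x` is a solution on `[0,T]` of the planar singularly perturbed impulsive
problem `μ x' = G(x)`, `μ Δx|_{t=θ i} = I(x,μ)` (`i = 1,…,p`), `x(0,μ) = x0`. -/
def IsPlanarImpSol (T : ℝ) (p : ℕ) (θ : ℕ → ℝ)
    (G : ℝ × ℝ → ℝ × ℝ) (I : ℝ × ℝ → ℝ → ℝ × ℝ)
    (μ : ℝ) (x0 : ℝ × ℝ) (x : ℝ → ℝ × ℝ) : Prop :=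
  x 0 = x0 ∧
  (∀ t ∈ Icc (0:ℝ) T, (∀ i ∈ Finset.Icc 1 p, t ≠ θ i) →
      ContinuousWithinAt x (Icc (0:ℝ) T) t) ∧
  (∀ i ∈ Finset.Icc 1 p, Tendsto x (𝓝[<] (θ i)) (𝓝 (x (θ i)))) ∧
  (∀ t ∈ Icc (0:ℝ) T, (∀ i ∈ Finset.Icc 1 p, t ≠ θ i) →
      HasDerivWithinAt x ((1/μ) • G (x t)) (Icc (0:ℝ) T \ (θ '' Icc 1 p)) t) ∧
  (∀ i ∈ Finset.Icc 1 p,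
      Tendsto x (𝓝[>] (θ i)) (𝓝 (x (θ i) + (1/μ) • I (x (θ i)) μ)))

/-- The time-`s` flow map of the linear field `v ↦ (-v.1 + v.2, -v.1 - v.2)`. -/
def planarFlow (s : ℝ) (v : ℝ × ℝ) : ℝ × ℝ :=
  (Real.exp (-s) * (v.1 * Real.cos s + v.2 * Real.sin s),
    Real.exp (-s) * (-v.1 * Real.sin s + v.2 * Real.cos s))

/-- The Lyapunov function `x₁² + x₂²`. -/
def planarEnergy (v : ℝ × ℝ) : ℝ := v.1 ^ 2 + v.2 ^ 2

lemma planarFlow_zero (v : ℝ × ℝ) : planarFlow 0 v = v := by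
  simp [planarFlow]

lemma hasDerivAt_planarFlow (v : ℝ × ℝ) (μ c t : ℝ) :
    HasDerivAt (fun t => planarFlow ((t - c) / μ) v)
      ((1 / μ) • ((fun w : ℝ × ℝ => (-w.1 + w.2, -w.1 - w.2)) (planarFlow ((t - c) / μ) v))) t := by
  have hs : HasDerivAt (fun t : ℝ => (t - c) / μ) (1 / μ) t :=
    ((hasDerivAt_id t).sub_const c).div_const μ
  have he := hs.neg.exp
  have h1 := he.mul ((hs.cos.const_mul v.1).add (hs.sin.const_mul v.2))
  have h2 := he.mul ((hs.sin.const_mul (-v.1)).add (hs.cos.const_mul v.2))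
  refine (h1.prodMk h2).congr_deriv ?_
  ext <;> simp [planarFlow] <;> ring

/-- The index `n ≤ 10` of the interval between consecutive impulse moments `i / 3` containing
`t`, with intervals open on the left and closed on the right. -/
def impulseIndex (t : ℝ) : ℕ := min 10 (⌈3 * t⌉₊ - 1)

lemma impulseIndex_eq {t : ℝ} {n : ℕ} (hn : n ≤ 10) (hl : (n : ℝ) / 3 < t ∨ n = 0)
    (hr : t ≤ ((n : ℝ) + 1) / 3 ∨ n = 10) : impulseIndex t = n := by
  have hle : n = 10 ∨ ⌈3 * t⌉₊ ≤ n + 1 := by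
    rcases hr with hr | hr
    · right
      rw [Nat.ceil_le]
      push_cast
      linarith
    · exact Or.inl hr
  have hlt : n = 0 ∨ n < ⌈3 * t⌉₊ := by
    rcases hl with hl | hl
    · right
      rw [Nat.lt_ceil]
      linarith
    · exact Or.inl hl
  unfold impulseIndex
  omega

/-- The impulse-free trajectory pieces glued together by the jump map `J` at the moments `i / 3`. -/
def gluedSolution (μ : ℝ) (J : ℝ × ℝ → ℝ × ℝ) (v₀ : ℝ × ℝ) (t : ℝ) : ℝ × ℝ :=
  planarFlow ((t - (impulseIndex t : ℝ) / 3) / μ)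
    ((fun v => J (planarFlow (1 / 3 / μ) v))^[impulseIndex t] v₀)

lemma gluedSolution_eq {μ : ℝ} {J : ℝ × ℝ → ℝ × ℝ} {v₀ : ℝ × ℝ} {t : ℝ} {n : ℕ}
    (h : impulseIndex t = n) :
    gluedSolution μ J v₀ t = planarFlow ((t - (n : ℝ) / 3) / μ)
      ((fun v => J (planarFlow (1 / 3 / μ) v))^[n] v₀) := by
  rw [gluedSolution, h]

lemma eventually_impulseIndex_eq {t : ℝ} (ht : ∀ i ∈ Finset.Icc 1 10, t ≠ (i : ℕ) / 3) :
    ∃ n : ℕ, ∀ᶠ s in 𝓝 t, impulseIndex s = n := by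
  by_cases h0 : t < 1 / 3
  · refine ⟨0, ?_⟩
    filter_upwards [eventually_lt_nhds h0] with s hs
    exact impulseIndex_eq (by norm_num) (Or.inr rfl) (Or.inl (by norm_num; linarith))
  by_cases h10 : 10 / 3 < t
  · refine ⟨10, ?_⟩
    filter_upwards [eventually_gt_nhds h10] with s hs
    exact impulseIndex_eq le_rfl (Or.inl (by norm_num; linarith)) (Or.inr rfl)
  push Not at h0 h10
  have hf : ⌊3 * t⌋₊ ≤ 10 := by
    refine Nat.floor_le_of_le ?_
    norm_num
    linarith
  have hf1 : 1 ≤ ⌊3 * t⌋₊ := Nat.le_floor (by norm_num; linarith)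
  have hlow := Nat.floor_le (show 0 ≤ 3 * t by linarith)
  have hup := Nat.lt_floor_add_one (3 * t)
  have hne := ht _ (Finset.mem_Icc.2 ⟨hf1, hf⟩)
  have hl : (⌊3 * t⌋₊ : ℝ) / 3 < t := lt_of_le_of_ne (by linarith) hne.symm
  have hr : t < ((⌊3 * t⌋₊ : ℝ) + 1) / 3 := by linarith
  refine ⟨⌊3 * t⌋₊, ?_⟩
  filter_upwards [eventually_gt_nhds hl, eventually_lt_nhds hr] with s hs hs'
  exact impulseIndex_eq hf (Or.inl hs) (Or.inl hs'.le)

lemma hasDerivAt_gluedSolution {μ : ℝ} {J : ℝ × ℝ → ℝ × ℝ} {v₀ : ℝ × ℝ} {t : ℝ}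
    (ht : ∀ i ∈ Finset.Icc 1 10, t ≠ (i : ℕ) / 3) :
    HasDerivAt (gluedSolution μ J v₀)
      ((1 / μ) • ((fun w : ℝ × ℝ => (-w.1 + w.2, -w.1 - w.2)) (gluedSolution μ J v₀ t))) t := by
  obtain ⟨n, hn⟩ := eventually_impulseIndex_eq ht
  rw [gluedSolution_eq hn.self_of_nhds]
  refine (hasDerivAt_planarFlow _ μ ((n : ℝ) / 3) t).congr_of_eventuallyEq ?_
  filter_upwards [hn] with s hs using gluedSolution_eq hs

lemma isPlanarImpSol_gluedSolution {I : ℝ × ℝ → ℝ → ℝ × ℝ} {μ : ℝ} {J : ℝ × ℝ → ℝ × ℝ}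
    (hJ : ∀ v, J v = v + (1 / μ) • I v μ) (v₀ : ℝ × ℝ) :
    IsPlanarImpSol 4 10 (fun i => (i : ℝ) / 3) (fun v => (-v.1 + v.2, -v.1 - v.2)) I μ v₀
      (gluedSolution μ J v₀) := by
  refine ⟨?_, fun t _ ht => (hasDerivAt_gluedSolution ht).continuousAt.continuousWithinAt, ?_,
    fun t _ ht => (hasDerivAt_gluedSolution ht).hasDerivWithinAt, ?_⟩
  · rw [gluedSolution_eq (n := 0)
      (impulseIndex_eq (by norm_num) (Or.inr rfl) (Or.inl (by norm_num)))]
    simp [planarFlow_zero]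
  · intro i hi
    obtain ⟨hi1, hi10⟩ := Finset.mem_Icc.1 hi
    obtain ⟨n, rfl⟩ : ∃ n, i = n + 1 := ⟨i - 1, by omega⟩
    have hlt : (n : ℝ) / 3 < ((n + 1 : ℕ) : ℝ) / 3 := by push_cast; linarith
    rw [gluedSolution_eq (n := n) (impulseIndex_eq (by omega) (Or.inl hlt)
      (Or.inl (by push_cast; exact le_rfl)))]
    refine ((hasDerivAt_planarFlow _ μ ((n : ℝ) / 3) _).continuousAt.tendsto.mono_left
      nhdsWithin_le_nhds).congr' ?_
    filter_upwards [Ioo_mem_nhdsLT hlt] with s hs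
    refine (gluedSolution_eq (impulseIndex_eq (by omega) (Or.inl hs.1) (Or.inl ?_))).symm
    have := hs.2.le
    push_cast at this
    exact this
  · intro i hi
    obtain ⟨hi1, hi10⟩ := Finset.mem_Icc.1 hi
    obtain ⟨n, rfl⟩ : ∃ n, i = n + 1 := ⟨i - 1, by omega⟩
    have hlt : (n : ℝ) / 3 < ((n + 1 : ℕ) : ℝ) / 3 := by push_cast; linarith
    have hlt' : ((n + 1 : ℕ) : ℝ) / 3 < (((n + 1 : ℕ) : ℝ) + 1) / 3 := by linarith
    have hlim := ((hasDerivAt_planarFlow ((fun v => J (planarFlow (1 / 3 / μ) v))^[n + 1] v₀) μ (((n + 1 : ℕ) : ℝ) / 3)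
      (((n + 1 : ℕ) : ℝ) / 3)).continuousAt.tendsto.mono_left
      (nhdsWithin_le_nhds (s := Ioi (((n + 1 : ℕ) : ℝ) / 3)))).congr'
      (f₂ := gluedSolution μ J v₀) (by
        filter_upwards [Ioo_mem_nhdsGT hlt'] with s hs
        exact (gluedSolution_eq (impulseIndex_eq hi10 (Or.inl hs.1) (Or.inl hs.2.le))).symm)
    have hpre : gluedSolution μ J v₀ (((n + 1 : ℕ) : ℝ) / 3) = planarFlow (1 / 3 / μ)
        ((fun v => J (planarFlow (1 / 3 / μ) v))^[n] v₀) := by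
      rw [gluedSolution_eq (n := n) (impulseIndex_eq (by omega) (Or.inl hlt)
        (Or.inl (by push_cast; exact le_rfl)))]
      congr 1
      push_cast
      ring
    rw [sub_self, zero_div, planarFlow_zero, Function.iterate_succ_apply', ← hpre, hJ] at hlim
    exact hlim

lemma continuous_planarEnergy : Continuous planarEnergy := by
  unfold planarEnergy
  fun_prop

lemma planarEnergy_nonneg (v : ℝ × ℝ) : 0 ≤ planarEnergy v := by
  unfold planarEnergy
  positivity

lemma hasDerivAt_exp_mul_planarEnergy {x : ℝ → ℝ × ℝ} {μ t : ℝ}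
    (h : HasDerivAt x ((1 / μ) • ((-(x t).1 + (x t).2, -(x t).1 - (x t).2) : ℝ × ℝ)) t) :
    HasDerivAt (fun t => Real.exp (2 * t / μ) * planarEnergy (x t)) 0 t := by
  have he : HasDerivAt (fun t : ℝ => Real.exp (2 * t / μ)) _ t :=
    (((hasDerivAt_id t).const_mul 2).div_const μ).exp
  have h1 : HasDerivAt (fun t => (x t).1) _ t := h.fst
  have h2 : HasDerivAt (fun t => (x t).2) _ t := h.snd
  refine (he.mul ((h1.pow 2).add (h2.pow 2))).congr_deriv ?_
  simp
  ring

/-- Exact exponential decay of the energy along the flow on an interval free of impulses. -/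
lemma planarEnergy_eq_of_hasDerivAt {x : ℝ → ℝ × ℝ} {μ s e : ℝ} {L : ℝ × ℝ}
    (hx : ∀ t ∈ Ioo s e,
      HasDerivAt x ((1 / μ) • ((-(x t).1 + (x t).2, -(x t).1 - (x t).2) : ℝ × ℝ)) t)
    (hs : Tendsto x (𝓝[>] s) (𝓝 L)) (he : Tendsto x (𝓝[<] e) (𝓝 (x e)))
    {t : ℝ} (ht : t ∈ Ioc s e) :
    planarEnergy (x t) = Real.exp (-(2 * (t - s) / μ)) * planarEnergy L := by
  set f : ℝ → ℝ := fun t => Real.exp (2 * t / μ) * planarEnergy (x t) with hf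
  have hexp : Continuous fun t : ℝ => Real.exp (2 * t / μ) := by fun_prop
  have hder : ∀ t ∈ Ioo s e, HasDerivAt f 0 t := fun t ht =>
    hasDerivAt_exp_mul_planarEnergy (hx t ht)
  have hconst : ∀ u ∈ Ioo s e, ∀ v ∈ Ioo s e, f u = f v := fun u hu v hv =>
    isOpen_Ioo.is_const_of_deriv_eq_zero isPreconnected_Ioo
      (fun w hw => (hder w hw).differentiableAt.differentiableWithinAt)
      (fun w hw => (hder w hw).deriv) hu hv
  have hse : s < e := ht.1.trans_le ht.2
  have hlims : Tendsto f (𝓝[>] s) (𝓝 (Real.exp (2 * s / μ) * planarEnergy L)) :=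
    (hexp.tendsto s |>.mono_left nhdsWithin_le_nhds).mul
      ((continuous_planarEnergy.tendsto L).comp hs)
  have hlime : Tendsto f (𝓝[<] e) (𝓝 (f e)) :=
    (hexp.tendsto e |>.mono_left nhdsWithin_le_nhds).mul
      ((continuous_planarEnergy.tendsto _).comp he)
  have hopen : ∀ u ∈ Ioo s e, f u = Real.exp (2 * s / μ) * planarEnergy L := fun u hu =>
    tendsto_nhds_unique (tendsto_const_nhds.congr' (by
      filter_upwards [Ioo_mem_nhdsGT hse] with v hv using hconst u hu v hv)) hlims
  have hend : f e = Real.exp (2 * s / μ) * planarEnergy L :=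
    tendsto_nhds_unique hlime (tendsto_const_nhds.congr' (by
      filter_upwards [Ioo_mem_nhdsLT hse] with v hv using (hopen v hv).symm))
  have hft : f t = Real.exp (2 * s / μ) * planarEnergy L := by
    rcases ht.2.lt_or_eq with h | h
    · exact hopen t ⟨ht.1, h⟩
    · rw [h, hend]
  have h1 : Real.exp (-(2 * (t - s) / μ)) * Real.exp (2 * t / μ) = Real.exp (2 * s / μ) := by
    rw [← Real.exp_add]
    congr 1
    ring
  refine mul_left_cancel₀ (Real.exp_ne_zero (2 * t / μ)) ?_
  rw [← mul_assoc, mul_comm _ (Real.exp (-_)), h1]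
  exact hft

lemma planarEnergy_jump_le {v : ℝ × ℝ} {μ : ℝ} (hμ : 0 < μ) (y : ℝ) :
    planarEnergy (v + (1 / μ) • ((-2 * μ * v.1, μ * Real.sin y) : ℝ × ℝ)) ≤
      2 * planarEnergy v + 2 := by
  have h1 : 1 / μ * (-2 * μ * v.1) = -2 * v.1 := by field_simp
  have h2 : 1 / μ * (μ * Real.sin y) = Real.sin y := by field_simp
  simp only [planarEnergy, Prod.fst_add, Prod.snd_add, Prod.smul_mk, smul_eq_mul, h1, h2]
  nlinarith [Real.sin_sq_le_one y, sq_nonneg (v.2 - Real.sin y), sq_nonneg v.1]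

section Solution

variable {I : ℝ × ℝ → ℝ → ℝ × ℝ} {μ : ℝ} {x₀ : ℝ × ℝ} {x : ℝ → ℝ × ℝ}

lemma ne_impulse_moment {n : ℕ} {t : ℝ} (hl : (n : ℝ) / 3 < t)
    (hr : t < ((n : ℝ) + 1) / 3 ∨ n = 10) :
    ∀ i ∈ Finset.Icc 1 10, t ≠ (i : ℕ) / 3 := by
  rintro i hi rfl
  have h1 : n < i := by
    have : (n : ℝ) < i := by linarith
    exact_mod_cast this
  have h10 := (Finset.mem_Icc.1 hi).2
  rcases hr with hr | hr
  · have : (i : ℝ) < n + 1 := by linarith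
    have : i < n + 1 := by exact_mod_cast this
    omega
  · omega

lemma IsPlanarImpSol.hasDerivAt
    (h : IsPlanarImpSol 4 10 (fun i => (i : ℝ) / 3) (fun v => (-v.1 + v.2, -v.1 - v.2)) I μ x₀ x)
    {t : ℝ} (ht : t ∈ Ioo (0 : ℝ) 4) (hne : ∀ i ∈ Finset.Icc 1 10, t ≠ (i : ℕ) / 3) :
    HasDerivAt x ((1 / μ) • ((-(x t).1 + (x t).2, -(x t).1 - (x t).2) : ℝ × ℝ)) t := by
  refine (h.2.2.2.1 t (Ioo_subset_Icc_self ht) hne).hasDerivAt ?_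
  have hfin : ((fun i : ℕ => (i : ℝ) / 3) '' Icc 1 10).Finite := (finite_Icc 1 10).image _
  refine inter_mem (Icc_mem_nhds ht.1 ht.2) (hfin.isClosed.isOpen_compl.mem_nhds ?_)
  rintro ⟨i, hi, rfl⟩
  exact hne i (Finset.mem_Icc.2 hi) rfl

/-- The right limit of a solution at the start of the `n`-th impulse-free interval. -/
def startValue (I : ℝ × ℝ → ℝ → ℝ × ℝ) (μ : ℝ) (x : ℝ → ℝ × ℝ) (n : ℕ) : ℝ × ℝ :=
  if n = 0 then x 0 else x ((n : ℝ) / 3) + (1 / μ) • I (x ((n : ℝ) / 3)) μ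

lemma IsPlanarImpSol.planarEnergy_eq
    (h : IsPlanarImpSol 4 10 (fun i => (i : ℝ) / 3) (fun v => (-v.1 + v.2, -v.1 - v.2)) I μ x₀ x)
    {n : ℕ} (hn : n ≤ 10) {t : ℝ} (hl : (n : ℝ) / 3 < t)
    (hr : t ≤ ((n : ℝ) + 1) / 3 ∨ n = 10) (ht4 : t ≤ 4) :
    planarEnergy (x t) =
      Real.exp (-(2 * (t - (n : ℝ) / 3) / μ)) * planarEnergy (startValue I μ x n) := by
  have hn0 : (0 : ℝ) ≤ n := Nat.cast_nonneg n
  have ht0 : 0 < t := by linarith [div_nonneg hn0 (by norm_num : (0 : ℝ) ≤ 3)]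
  refine planarEnergy_eq_of_hasDerivAt (e := t) (s := (n : ℝ) / 3) ?_ ?_ ?_ ⟨hl, le_rfl⟩
  · intro u hu
    refine h.hasDerivAt ⟨by linarith [hu.1, div_nonneg hn0 (by norm_num : (0 : ℝ) ≤ 3)],
      hu.2.trans_le ht4⟩ (ne_impulse_moment hu.1 (hr.imp_left hu.2.trans_le))
  · unfold startValue
    split_ifs with h0
    · subst h0
      have hc := h.2.1 0 ⟨le_rfl, by norm_num⟩ (fun i hi h0 => by
        have := (Finset.mem_Icc.1 hi).1
        have : (1 : ℝ) ≤ i := by exact_mod_cast this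
        simp only at h0
        linarith)
      have hle : 𝓝[>] (0 : ℝ) ≤ 𝓝[Icc 0 4] 0 :=
        nhdsWithin_le_iff.2 (mem_of_superset (Ioo_mem_nhdsGT (by norm_num : (0 : ℝ) < 4))
          Ioo_subset_Icc_self)
      simpa using hc.tendsto.mono_left hle
    · exact h.2.2.2.2 n (Finset.mem_Icc.2 ⟨by omega, hn⟩)
  · by_cases hi : ∃ i ∈ Finset.Icc 1 10, t = (i : ℕ) / 3
    · obtain ⟨i, hi, rfl⟩ := hi
      exact h.2.2.1 i hi
    · push Not at hi
      have hle : 𝓝[<] t ≤ 𝓝[Icc 0 4] t :=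
        nhdsWithin_le_iff.2 (mem_of_superset (Ioo_mem_nhdsLT ht0)
          fun u hu => ⟨hu.1.le, hu.2.le.trans ht4⟩)
      exact (h.2.1 t ⟨ht0.le, ht4⟩ hi).tendsto.mono_left hle

lemma IsPlanarImpSol.exists_planarEnergy_startValue_le (x₀ : ℝ × ℝ)
    (y : ℝ × ℝ → ℝ → ℝ) (n : ℕ) (hn : n ≤ 10) :
    ∃ C : ℝ, ∀ μ > 0, ∀ x : ℝ → ℝ × ℝ,
      IsPlanarImpSol 4 10 (fun i => (i : ℝ) / 3) (fun v => (-v.1 + v.2, -v.1 - v.2))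
        (fun v μ => (-2 * μ * v.1, μ * Real.sin (y v μ))) μ x₀ x →
      planarEnergy (startValue (fun v μ => (-2 * μ * v.1, μ * Real.sin (y v μ))) μ x n) ≤ C := by
  induction n with
  | zero =>
    refine ⟨planarEnergy x₀, fun μ _ x h => ?_⟩
    simp [startValue, h.1]
  | succ k ih =>
    obtain ⟨C, hC⟩ := ih (by omega)
    refine ⟨2 * C + 2, fun μ hμ x h => ?_⟩
    have hk : (k : ℝ) ≤ 9 := by exact_mod_cast (by omega : k ≤ 9)
    have hE := h.planarEnergy_eq (n := k) (t := ((k + 1 : ℕ) : ℝ) / 3) (by omega)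
      (by push_cast; linarith) (Or.inl (by push_cast; exact le_rfl)) (by push_cast; linarith)
    have hexp : Real.exp (-(2 * (((k + 1 : ℕ) : ℝ) / 3 - (k : ℝ) / 3) / μ)) ≤ 1 := by
      rw [Real.exp_le_one_iff, neg_nonpos]
      have : 0 ≤ ((k + 1 : ℕ) : ℝ) / 3 - (k : ℝ) / 3 := by push_cast; linarith
      positivity
    have hle := mul_le_of_le_one_left (planarEnergy_nonneg
      (startValue (fun v μ => (-2 * μ * v.1, μ * Real.sin (y v μ))) μ x k)) hexp
    rw [← hE] at hle
    rw [startValue, if_neg (Nat.succ_ne_zero k)]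
    linarith [planarEnergy_jump_le (v := x (((k + 1 : ℕ) : ℝ) / 3)) hμ
      (y (x (((k + 1 : ℕ) : ℝ) / 3)) μ), hC μ hμ x h]

end Solution

lemma exists_impulse_interval {t : ℝ} (ht : 0 < t) :
    ∃ n : ℕ, n ≤ 10 ∧ (n : ℝ) / 3 < t ∧ (t ≤ ((n : ℝ) + 1) / 3 ∨ n = 10) := by
  have hpos : 0 < ⌈3 * t⌉₊ := Nat.ceil_pos.2 (by linarith)
  by_cases h : ⌈3 * t⌉₊ ≤ 11
  · obtain ⟨n, hn⟩ : ∃ n, ⌈3 * t⌉₊ = n + 1 := ⟨⌈3 * t⌉₊ - 1, by omega⟩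
    have h1 : (n : ℝ) < 3 * t := Nat.lt_ceil.1 (by omega)
    have h2 : 3 * t ≤ ((n + 1 : ℕ) : ℝ) := Nat.ceil_le.1 hn.le
    push_cast at h2
    exact ⟨n, by omega, by linarith, Or.inl (by linarith)⟩
  · have h1 : ((10 : ℕ) : ℝ) < 3 * t := Nat.lt_ceil.1 (by omega)
    exact ⟨10, le_rfl, by rw [div_lt_iff₀ three_pos]; linarith, Or.inr rfl⟩

lemma tendsto_exp_neg_div_nhdsGT_zero {c : ℝ} (hc : 0 < c) :
    Tendsto (fun μ : ℝ => Real.exp (-(c / μ))) (𝓝[>] 0) (𝓝 0) := by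
  refine Real.tendsto_exp_neg_atTop_nhds_zero.comp ?_
  exact (tendsto_inv_nhdsGT_zero.const_mul_atTop hc).congr fun μ => (div_eq_mul_inv c μ).symm

lemma tendsto_zero_of_planarEnergy {α : Type*} {l : Filter α} {f : α → ℝ × ℝ}
    (h : Tendsto (fun a => planarEnergy (f a)) l (𝓝 0)) : Tendsto f l (𝓝 (0, 0)) := by
  have hs : Tendsto (fun a => √(planarEnergy (f a))) l (𝓝 0) := by
    simpa using h.sqrt
  refine Tendsto.prodMk_nhds (squeeze_zero_norm (fun a => Real.abs_le_sqrt ?_) hs)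
    (squeeze_zero_norm (fun a => Real.abs_le_sqrt ?_) hs) <;>
  · unfold planarEnergy
    nlinarith [sq_nonneg (f a).1, sq_nonneg (f a).2]

/-- Example 1: the planar system `μ x₁' = −x₁ + x₂`, `μ x₂' = −x₁ − x₂`,
`μ Δx₁|_{t=θ i} = −2μx₁`, `μ Δx₂|_{t=θ i} = μ sin(x₂^{1/3} + μ)`, with
`θ i = i/3`, `i = 1,…,10`, `T = 4`.  For every initial value `(a,b)` the
solution exists on `[0,4]` for all sufficiently small `μ > 0` and tends to
`(0,0)` as `μ → 0+` for every `t ∈ (0,4]`. -/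
theorem example_planar_single_layer (a b : ℝ) :
    ∃ μ₀ > (0:ℝ),
      (∀ μ ∈ Ioc (0:ℝ) μ₀, ∃ x : ℝ → ℝ × ℝ,
        IsPlanarImpSol 4 10 (fun i => (i:ℝ)/3)
          (fun v => (-v.1 + v.2, -v.1 - v.2))
          (fun v μ => (-2*μ*v.1, μ * Real.sin (cbrt v.2 + μ))) μ (a, b) x) ∧
      ∀ X : ℝ → ℝ → ℝ × ℝ,
        (∀ μ ∈ Ioc (0:ℝ) μ₀,
          IsPlanarImpSol 4 10 (fun i => (i:ℝ)/3)
            (fun v => (-v.1 + v.2, -v.1 - v.2))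
            (fun v μ => (-2*μ*v.1, μ * Real.sin (cbrt v.2 + μ))) μ (a, b) (X μ)) →
        ∀ t ∈ Ioc (0:ℝ) 4,
          Tendsto (fun μ => X μ t) (𝓝[>] (0:ℝ)) (𝓝 ((0:ℝ), (0:ℝ))) := by
  refine ⟨1, one_pos, fun μ _ => ⟨_, isPlanarImpSol_gluedSolution (fun _ => rfl) (a, b)⟩, ?_⟩
  intro X hX t ht
  obtain ⟨n, hn, hl, hr⟩ := exists_impulse_interval ht.1
  obtain ⟨C, hC⟩ := IsPlanarImpSol.exists_planarEnergy_startValue_le (a, b)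
    (fun v μ => cbrt v.2 + μ) n hn
  have hlim := (tendsto_exp_neg_div_nhdsGT_zero
    (mul_pos two_pos (sub_pos.2 hl))).mul_const C
  rw [zero_mul] at hlim
  refine tendsto_zero_of_planarEnergy (squeeze_zero' (Eventually.of_forall fun μ =>
    planarEnergy_nonneg _) ?_ hlim)
  filter_upwards [Ioc_mem_nhdsGT (one_pos : (0 : ℝ) < 1)] with μ hμ
  rw [(hX μ hμ).planarEnergy_eq hn hl hr ht.2]
  exact mul_le_mul_of_nonneg_left (hC μ hμ.1 _ (hX μ hμ)) (Real.exp_nonneg _)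
end
end

section
/- Consider the singularly perturbed system μ z' = z(1 − z − 2y); y' = y(1 − 2z − y) with impulse condition Δy|_{t=η_j} = y² − y + z at the moments η_j = j/3, j = 1,…,5, on the interval [0,T] with T = 2, and initial conditions z(0,μ) = 1, y(0,μ) = 2. Let ȳ(t) be the unique solution of the degenerate problem ȳ' = ȳ(1 − ȳ), Δȳ|_{t=η_j} = ȳ² − ȳ, ȳ(0) = 2 on [0,T] (obtained by substituting the root z = 0 of z(1 − z − 2y) = 0, which is uniformly asymptotically stable for the adjoint system dz/dτ = z(1 − z − 2y) whenever y > 1/2). Then for all sufficiently small μ > 0 the solution (z(t,μ), y(t,μ)) exists on [0,T] and satisfies lim_{μ→0+} y(t,μ) = ȳ(t) for every t ∈ [0,T] and lim_{μ→0+} z(t,μ) = 0 for every t ∈ (0,T]. -/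
open Filter Topology Set

noncomputable section

/-- `(z,y)` is a solution on `[0,T]` of the singularly perturbed problem
`μ z' = F(z,y)`, `y' = f(z,y)`, `Δy|_{t=η j} = J(z,y)` (`j = 1,…,k`),
`z(0,μ) = z0`, `y(0,μ) = y0`: `z` is continuous, `y` is continuous except
possibly at the `η j`, where it is left-continuous with a right limit
satisfying the jump condition. -/
def IsSlowFastSol (T : ℝ) (k : ℕ) (η : ℕ → ℝ)
    (F f J : ℝ → ℝ → ℝ)
    (μ : ℝ) (z0 y0 : ℝ) (z y : ℝ → ℝ) : Prop :=
  z 0 = z0 ∧ y 0 = y0 ∧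
  (∀ t ∈ Icc (0:ℝ) T, ContinuousWithinAt z (Icc (0:ℝ) T) t) ∧
  (∀ t ∈ Icc (0:ℝ) T, (∀ j ∈ Finset.Icc 1 k, t ≠ η j) →
      ContinuousWithinAt y (Icc (0:ℝ) T) t) ∧
  (∀ j ∈ Finset.Icc 1 k, Tendsto y (𝓝[<] (η j)) (𝓝 (y (η j)))) ∧
  (∀ j ∈ Finset.Icc 1 k,
      Tendsto y (𝓝[>] (η j)) (𝓝 (y (η j) + J (z (η j)) (y (η j))))) ∧
  (∀ t ∈ Icc (0:ℝ) T, (∀ j ∈ Finset.Icc 1 k, t ≠ η j) →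
      HasDerivWithinAt z ((1/μ) * F (z t) (y t)) (Icc (0:ℝ) T \ (η '' Icc 1 k)) t ∧
      HasDerivWithinAt y (f (z t) (y t)) (Icc (0:ℝ) T \ (η '' Icc 1 k)) t)

/-- `yb` is a solution on `[0,T]` of the degenerate impulsive problem
`ȳ' = g(ȳ)`, `Δȳ|_{t=η j} = Jb(ȳ)` (`j = 1,…,k`), `ȳ(0) = y0`. -/
def IsDegenSol1 (T : ℝ) (k : ℕ) (η : ℕ → ℝ)
    (g Jb : ℝ → ℝ) (y0 : ℝ) (yb : ℝ → ℝ) : Prop :=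
  yb 0 = y0 ∧
  (∀ t ∈ Icc (0:ℝ) T, (∀ j ∈ Finset.Icc 1 k, t ≠ η j) →
      ContinuousWithinAt yb (Icc (0:ℝ) T) t) ∧
  (∀ j ∈ Finset.Icc 1 k, Tendsto yb (𝓝[<] (η j)) (𝓝 (yb (η j)))) ∧
  (∀ j ∈ Finset.Icc 1 k,
      Tendsto yb (𝓝[>] (η j)) (𝓝 (yb (η j) + Jb (yb (η j))))) ∧
  (∀ t ∈ Icc (0:ℝ) T, (∀ j ∈ Finset.Icc 1 k, t ≠ η j) →
      HasDerivWithinAt yb (g (yb t)) (Icc (0:ℝ) T \ (η '' Icc 1 k)) t)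

/-! ### Scalar comparison lemmas -/

/-- A function continuous on `[a,b]` whose derivative on `(a,b)` is the restriction of a function
continuous on `[a,b]` is right-differentiable on `[a,b)`. -/
lemma hasDerivWithinAt_Ici_of_Ioo {f f' : ℝ → ℝ} {a b : ℝ}
    (hf : ContinuousOn f (Icc a b)) (hf' : ContinuousOn f' (Icc a b))
    (hd : ∀ t ∈ Ioo a b, HasDerivAt f (f' t) t) :
    ∀ t ∈ Ico a b, HasDerivWithinAt f (f' t) (Ici t) t := by
  intro t ht
  rcases eq_or_lt_of_le ht.1 with rfl | hat
  · have hnhds : Ioo a b ∈ 𝓝[>] a := Ioo_mem_nhdsGT ht.2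
    refine hasDerivWithinAt_Ici_of_tendsto_deriv (s := Ioo a b)
      (fun x hx => (hd x hx).differentiableAt.differentiableWithinAt)
      ((hf a (left_mem_Icc.2 ht.2.le)).mono Ioo_subset_Icc_self) hnhds ?_
    have h1 : Tendsto f' (𝓝[>] a) (𝓝 (f' a)) :=
      (hf' a (left_mem_Icc.2 ht.2.le)).mono_left <|
        nhdsWithin_le_iff.2 (mem_of_superset hnhds Ioo_subset_Icc_self)
    refine h1.congr' ?_
    filter_upwards [hnhds] with x hx using (hd x hx).deriv.symm
  · exact (hd t ⟨hat, ht.2⟩).hasDerivWithinAt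

/-- Strict barrier from above by a constant. -/
lemma le_const_of_deriv_neg {f f' : ℝ → ℝ} {a b M : ℝ}
    (hf : ContinuousOn f (Icc a b)) (hf' : ContinuousOn f' (Icc a b))
    (hd : ∀ t ∈ Ioo a b, HasDerivAt f (f' t) t) (ha : f a ≤ M)
    (hM : ∀ t ∈ Icc a b, f t = M → f' t < 0) : ∀ t ∈ Icc a b, f t ≤ M := by
  intro t ht
  exact image_le_of_deriv_right_lt_deriv_boundary hf (hasDerivWithinAt_Ici_of_Ioo hf hf' hd)
    (B := fun _ => M) (B' := fun _ => 0) ha (fun x => hasDerivAt_const x M)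
    (fun x hx h => hM x (Ico_subset_Icc_self hx) h) ht

/-- A solution of the linear equation `f' = f g` stays positive. -/
lemma pos_of_hasDerivAt_mul_self {f g : ℝ → ℝ} {a b : ℝ}
    (hf : ContinuousOn f (Icc a b)) (hg : ContinuousOn g (Icc a b))
    (hd : ∀ t ∈ Ioo a b, HasDerivAt f (f t * g t) t) (ha : 0 < f a) :
    ∀ t ∈ Icc a b, 0 < f t := by
  obtain ⟨C, hC⟩ := isCompact_Icc.exists_bound_of_continuousOn hg
  have hB : ∀ x, HasDerivAt (fun t => -(f a * Real.exp (-(C + 1) * (t - a))))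
      (-(f a * (Real.exp (-(C + 1) * (x - a)) * (-(C + 1))))) x := by
    intro x
    have h1 : HasDerivAt (fun t : ℝ => -(C + 1) * (t - a)) (-(C + 1)) x := by
      simpa using ((hasDerivAt_id x).sub_const a).const_mul (-(C + 1))
    exact (h1.exp.const_mul (f a)).neg
  intro t ht
  have key := image_le_of_deriv_right_lt_deriv_boundary hf.neg
    (fun x hx => (hasDerivWithinAt_Ici_of_Ioo hf (hf.mul hg) hd x hx).neg)
    (B := fun t => -(f a * Real.exp (-(C + 1) * (t - a)))) (by simp) hB
    (fun x hx h => by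
      have h2 : f x = f a * Real.exp (-(C + 1) * (x - a)) := by simpa using h
      have h3 : 0 < f x := by rw [h2]; positivity
      have h4 := (abs_le.1 (hC x (Ico_subset_Icc_self hx))).1
      have h5 : -(f a * (Real.exp (-(C + 1) * (x - a)) * (-(C + 1)))) = f x * (C + 1) := by
        rw [h2]; ring
      rw [h5]
      simp only [Pi.mul_apply]
      nlinarith) ht
  have h6 : 0 < f a * Real.exp (-(C + 1) * (t - a)) := by positivity
  simp only [Pi.neg_apply] at key
  linarith

lemma antitoneOn_Icc_of_hasDerivAt_nonpos {f f' : ℝ → ℝ} {a b : ℝ}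
    (hf : ContinuousOn f (Icc a b)) (hd : ∀ t ∈ Ioo a b, HasDerivAt f (f' t) t)
    (hf' : ∀ t ∈ Ioo a b, f' t ≤ 0) : AntitoneOn f (Icc a b) := by
  refine antitoneOn_of_hasDerivWithinAt_nonpos (f' := f') (convex_Icc a b) hf ?_ ?_
  · intro x hx
    rw [interior_Icc] at hx ⊢
    exact (hd x hx).hasDerivWithinAt
  · intro x hx
    rw [interior_Icc] at hx
    exact hf' x hx

/-! ### A priori estimates on an interval without impulses -/

/-- `(z,y)` is a solution of the slow-fast system on `[a,b]`. -/
structure IsSmoothSol (a b μ : ℝ) (z y : ℝ → ℝ) : Prop where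
  contz : ContinuousOn z (Icc a b)
  conty : ContinuousOn y (Icc a b)
  derivz : ∀ t ∈ Ioo a b, HasDerivAt z ((1/μ) * (z t * (1 - z t - 2 * y t))) t
  derivy : ∀ t ∈ Ioo a b, HasDerivAt y (y t * (1 - 2 * z t - y t)) t

/-- `w` is a solution of the logistic equation on `[a,b]`. -/
structure IsLogisticSol (a b : ℝ) (w : ℝ → ℝ) : Prop where
  cont : ContinuousOn w (Icc a b)
  deriv : ∀ t ∈ Ioo a b, HasDerivAt w (w t * (1 - w t)) t

namespace IsSmoothSol

variable {a b μ : ℝ} {z y : ℝ → ℝ}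

lemma z_pos (h : IsSmoothSol a b μ z y) (hz : 0 < z a) : ∀ t ∈ Icc a b, 0 < z t := by
  have hcz := h.contz
  have hcy := h.conty
  refine pos_of_hasDerivAt_mul_self (g := fun t => (1/μ) * (1 - z t - 2 * y t)) hcz
    (by fun_prop) (fun t ht => ?_) hz
  exact (h.derivz t ht).congr_deriv (by ring)

lemma y_pos (h : IsSmoothSol a b μ z y) (hy : 0 < y a) : ∀ t ∈ Icc a b, 0 < y t := by
  have hcz := h.contz
  have hcy := h.conty
  exact pos_of_hasDerivAt_mul_self (g := fun t => 1 - 2 * z t - y t) hcy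
    (by fun_prop) h.derivy hy

lemma z_le (h : IsSmoothSol a b μ z y) (hμ : 0 < μ) (hz1 : z a ≤ 1) (hy : 0 < y a) :
    ∀ t ∈ Icc a b, z t ≤ 1 := by
  have hcz := h.contz
  have hcy := h.conty
  refine le_const_of_deriv_neg (f' := fun t => (1/μ) * (z t * (1 - z t - 2 * y t))) hcz
    (by fun_prop) h.derivz hz1 (fun t ht h1 => ?_)
  have h2 := h.y_pos hy t ht
  refine mul_neg_of_pos_of_neg (by positivity) ?_
  rw [h1]
  linarith

lemma y_le (h : IsSmoothSol a b μ z y) {M : ℝ} (hM : 1 ≤ M) (hz : 0 < z a)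
    (hyM : y a ≤ M) : ∀ t ∈ Icc a b, y t ≤ M := by
  have hcz := h.contz
  have hcy := h.conty
  refine le_const_of_deriv_neg (f' := fun t => y t * (1 - 2 * z t - y t)) hcy
    (by fun_prop) h.derivy hyM (fun t ht h1 => ?_)
  have h2 := h.z_pos hz t ht
  rw [h1]
  exact mul_neg_of_pos_of_neg (by linarith) (by linarith)

/-- The slow variable, corrected by a multiple of `μ z`, cannot cross the level `4/5`. -/
lemma four_fifths_le (h : IsSmoothSol a b μ z y) (hμ : 0 < μ) (hμ1 : μ ≤ 1/20) (hz : 0 < z a)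
    (hz1 : z a ≤ 1) (hy : 0 < y a) (hya : 4/5 ≤ y a - 3 * μ * z a) :
    ∀ t ∈ Icc a b, 4/5 ≤ y t := by
  have hcz := h.contz
  have hcy := h.conty
  have key := le_const_of_deriv_neg (f := fun t => 3 * μ * z t - y t) (M := -(4/5))
    (f' := fun t => 3 * (z t * (1 - z t - 2 * y t)) - y t * (1 - 2 * z t - y t))
    (by fun_prop) (by fun_prop) (a := a) (b := b)
    (fun t ht => by
      exact (((h.derivz t ht).const_mul (3 * μ)).sub (h.derivy t ht)).congr_deriv
        (by field_simp)) (by linarith)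
    (fun t ht h1 => by
      have h2 := h.z_pos hz t ht
      have h3 := h.z_le hμ hz1 hy t ht
      have h4 : 4/5 ≤ y t := by nlinarith
      have h5 : y t < 1 := by nlinarith
      nlinarith [mul_pos h2 (sub_pos.2 h5), mul_nonneg h2.le (sub_nonneg.2 h4)])
  intro t ht
  have h2 := h.z_pos hz t ht
  have h3 := key t ht
  have h4 : 0 ≤ 3 * μ * z t := by positivity
  linarith

/-- Decay of the fast variable. -/
lemma z_mul_le (h : IsSmoothSol a b μ z y) (hμ : 0 < μ) (hz : 0 < z a)
    (hy : ∀ t ∈ Icc a b, 4/5 ≤ y t) :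
    ∀ t ∈ Icc a b, z t * (μ + 3/5 * (t - a)) ≤ μ * z a := by
  have hcz := h.contz
  have hanti : AntitoneOn (fun t => z t * (μ + 3/5 * (t - a))) (Icc a b) := by
    refine antitoneOn_Icc_of_hasDerivAt_nonpos (by fun_prop) (fun t ht =>
      (h.derivz t ht).mul (((((hasDerivAt_id t).sub_const a).const_mul (3/5)).const_add μ))) ?_
    intro t ht
    have h1 := h.z_pos hz t (Ioo_subset_Icc_self ht)
    have h2 := hy t (Ioo_subset_Icc_self ht)
    have h3 : 0 < t - a := sub_pos.2 ht.1
    have h4 : 1 / μ * (z t * (1 - z t - 2 * y t)) * (μ + 3/5 * (t - a))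
        = z t * (1 - z t - 2 * y t) * (1 + 3/5 * (t - a) / μ) := by field_simp
    have h5 : 0 ≤ 3/5 * (t - a) / μ := by positivity
    rw [h4]
    nlinarith [mul_nonneg h1.le h5, mul_nonneg h1.le (sub_nonneg.2 h2), mul_pos h1 h1,
      mul_nonneg (mul_nonneg h1.le (sub_nonneg.2 h2)) h5, mul_nonneg (mul_pos h1 h1).le h5]
  intro t ht
  have := hanti (left_mem_Icc.2 (ht.1.trans ht.2)) ht ht.1
  simp only [sub_self, mul_zero, add_zero] at this
  linarith

end IsSmoothSol

namespace IsLogisticSol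

variable {a b : ℝ} {w : ℝ → ℝ}

lemma one_lt (h : IsLogisticSol a b w) (hw : 1 < w a) : ∀ t ∈ Icc a b, 1 < w t := by
  have hcw := h.cont
  intro t ht
  refine sub_pos.1 (pos_of_hasDerivAt_mul_self (f := fun t => w t - 1) (g := fun t => - w t)
    (by fun_prop) (by fun_prop) (fun s hs => ?_) (sub_pos.2 hw) t ht)
  exact ((h.deriv s hs).sub_const 1).congr_deriv (by ring)

lemma le (h : IsLogisticSol a b w) {M : ℝ} (hM : 1 < M) (hw : w a ≤ M) :
    ∀ t ∈ Icc a b, w t ≤ M := by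
  have hcw := h.cont
  refine le_const_of_deriv_neg (f' := fun t => w t * (1 - w t)) hcw (by fun_prop) h.deriv hw
    (fun t _ h1 => ?_)
  rw [h1]
  exact mul_neg_of_pos_of_neg (by linarith) (by linarith)

end IsLogisticSol

/-- The squared distance between the slow variable and the degenerate solution. -/
lemma IsSmoothSol.sq_sub_le {a b μ M : ℝ} {z y w : ℝ → ℝ} (h : IsSmoothSol a b μ z y)
    (hw : IsLogisticSol a b w) (hμ : 0 < μ) (hM : 1 < M) (hz : 0 < z a)
    (hy : ∀ t ∈ Icc a b, 4/5 ≤ y t) (hyM : y a ≤ M) (hw1 : 1 < w a) (hwM : w a ≤ M) :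
    ∀ t ∈ Icc a b, (y t - w t) ^ 2 ≤ (y a - w a) ^ 2 + 10 * M ^ 2 * μ * z a := by
  have hcz := h.contz
  have hcy := h.conty
  have hcw := hw.cont
  have hanti : AntitoneOn (fun t => (y t - w t) ^ 2 + 10 * M ^ 2 * μ * z t) (Icc a b) := by
    refine antitoneOn_Icc_of_hasDerivAt_nonpos (by fun_prop) (fun t ht =>
      (((h.derivy t ht).sub (hw.deriv t ht)).pow 2).add
        ((h.derivz t ht).const_mul (10 * M ^ 2 * μ))) ?_
    intro t ht
    have ht' := Ioo_subset_Icc_self ht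
    have h1 := h.z_pos hz t ht'
    have h2 := hy t ht'
    have h3 := h.y_le hM.le hz hyM t ht'
    have h4 := hw.one_lt hw1 t ht'
    have h5 := hw.le hM hwM t ht'
    have h6 : 10 * M ^ 2 * μ * (1 / μ * (z t * (1 - z t - 2 * y t)))
        = 10 * M ^ 2 * (z t * (1 - z t - 2 * y t)) := by field_simp
    have h7 : y t * (w t - y t) ≤ M * M :=
      (mul_le_mul_of_nonneg_left (by linarith : w t - y t ≤ M) (by linarith)).trans
        (mul_le_mul_of_nonneg_right h3 (by linarith))
    have h8 : z t * (1 - z t - 2 * y t) ≤ z t * (-(3/5)) :=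
      mul_le_mul_of_nonneg_left (by linarith) h1.le
    have h9 := mul_le_mul_of_nonneg_left h8 (by positivity : 0 ≤ 10 * M ^ 2)
    have h10 := mul_le_mul_of_nonneg_left h7 (by positivity : 0 ≤ 4 * z t)
    have h11 : 0 ≤ (y t - w t) ^ 2 * (y t + w t - 1) :=
      mul_nonneg (sq_nonneg _) (by linarith)
    have h12 : 0 ≤ M * M * z t := by positivity
    rw [h6]
    simp only [Pi.sub_apply, Nat.cast_ofNat, Nat.add_one_sub_one, pow_one]
    nlinarith
  intro t ht
  have h1 := hanti (left_mem_Icc.2 (ht.1.trans ht.2)) ht ht.1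
  have h2 := h.z_pos hz t ht
  have h3 : 0 ≤ 10 * M ^ 2 * μ * z t := by positivity
  simp only at h1
  linarith

/-! ### Existence on an interval without impulses -/

/-- Global solvability of an autonomous equation with bounded Lipschitz right-hand side. -/
lemma exists_hasDerivWithinAt_of_bounded_lipschitz {E : Type*} [NormedAddCommGroup E]
    [NormedSpace ℝ E] [CompleteSpace E] {G : E → E} {K L : NNReal} (hK : LipschitzWith K G)
    (hL : ∀ x, ‖G x‖ ≤ L) {a b : ℝ} (hab : a ≤ b) (x₀ : E) :
    ∃ α : ℝ → E, α a = x₀ ∧ ∀ t ∈ Icc a b, HasDerivWithinAt α (G (α t)) (Icc a b) t := by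
  have hP : IsPicardLindelof (fun _ => G) (tmin := a) (tmax := b) ⟨a, left_mem_Icc.2 hab⟩ x₀
      (L * (b - a).toNNReal) 0 L K := by
    refine IsPicardLindelof.of_time_independent (fun x _ => hL x) (hK.lipschitzOnWith) ?_
    have : 0 ≤ b - a := sub_nonneg.2 hab
    simp [this]
  exact hP.exists_eq_forall_mem_Icc_hasDerivWithinAt₀

lemma abs_exp_min_sub_le (m a b : ℝ) :
    |Real.exp (min a m) - Real.exp (min b m)| ≤ Real.exp m * |a - b| := by
  have key : ∀ a b : ℝ, Real.exp (min a m) - Real.exp (min b m) ≤ Real.exp m * |a - b| := by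
    intro a b
    have h1 := Real.add_one_le_exp (min b m - min a m)
    have h2 : Real.exp (min b m) = Real.exp (min a m) * Real.exp (min b m - min a m) := by
      rw [← Real.exp_add]; congr 1; ring
    have h3 : Real.exp (min a m) ≤ Real.exp m := Real.exp_le_exp.2 (min_le_right _ _)
    have h4 : |min a m - min b m| ≤ |a - b| := by
      simpa using abs_min_sub_min_le_max a m b m
    have h5 := (le_abs_self _).trans h4
    have h6 := Real.exp_pos (min a m)
    rw [h2]
    calc Real.exp (min a m) - Real.exp (min a m) * Real.exp (min b m - min a m)
        ≤ Real.exp (min a m) * |a - b| := by nlinarith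
      _ ≤ Real.exp m * |a - b| := mul_le_mul_of_nonneg_right h3 (abs_nonneg _)
  refine abs_sub_le_iff.2 ⟨key a b, ?_⟩
  rw [abs_sub_comm]
  exact key b a

/-- The slow-fast system has a solution on every interval for positive initial data. -/
lemma exists_smooth_solution {μ a b z0 y0 : ℝ} (hab : a ≤ b) (hz0 : 0 < z0)
    (hy0 : 0 < y0) (hμ : 0 < μ) :
    ∃ z y : ℝ → ℝ, z a = z0 ∧ y a = y0 ∧ (∀ t ∈ Icc a b, 0 < z t ∧ 0 < y t) ∧
      ∀ t ∈ Icc a b,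
        HasDerivWithinAt z ((1/μ) * (z t * (1 - z t - 2 * y t))) (Icc a b) t ∧
        HasDerivWithinAt y (y t * (1 - 2 * z t - y t)) (Icc a b) t := by
  -- logarithmic coordinates, with the nonlinearity truncated above the level `m`
  set m : ℝ := max (max (Real.log z0) (Real.log y0)) 0 with hm
  have hm0 : 0 ≤ m := le_max_right _ _
  have hzm : Real.log z0 ≤ m := (le_max_left _ _).trans (le_max_left _ _)
  have hym : Real.log y0 ≤ m := (le_max_right _ _).trans (le_max_left _ _)
  set φ : ℝ → ℝ := fun x => Real.exp (min x m) with hφ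
  have hφc : Continuous φ := by fun_prop
  have hφ0 : ∀ x, 0 < φ x := fun x => Real.exp_pos _
  have hφm : ∀ x, φ x ≤ Real.exp m := fun x => Real.exp_le_exp.2 (min_le_right _ _)
  have hφl : ∀ x x', |φ x - φ x'| ≤ Real.exp m * |x - x'| := abs_exp_min_sub_le m
  have hφ1 : 1 ≤ φ m := by simpa [hφ] using hm0
  have hE : 0 < Real.exp m := Real.exp_pos m
  set G : ℝ × ℝ → ℝ × ℝ :=
    fun p => ((1/μ) * (1 - φ p.1 - 2 * φ p.2), 1 - 2 * φ p.1 - φ p.2) with hG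
  have hμ' : 0 < 1/μ := by positivity
  have hK : LipschitzWith ((1/μ + 1) * (3 * Real.exp m)).toNNReal G := by
    refine LipschitzWith.of_dist_le_mul fun p q => ?_
    rw [Real.coe_toNNReal _ (by positivity)]
    have h1 : |p.1 - q.1| ≤ dist p q := by
      rw [← Real.dist_eq]; exact le_max_left _ _
    have h2 : |p.2 - q.2| ≤ dist p q := by
      rw [← Real.dist_eq]; exact le_max_right _ _
    have h3 := (hφl p.1 q.1).trans (mul_le_mul_of_nonneg_left h1 hE.le)
    have h4 := (hφl p.2 q.2).trans (mul_le_mul_of_nonneg_left h2 hE.le)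
    rw [abs_le] at h3 h4
    have h5 : |(1 - φ p.1 - 2 * φ p.2) - (1 - φ q.1 - 2 * φ q.2)|
        ≤ 3 * Real.exp m * dist p q := by
      rw [abs_le]; constructor <;> linarith [h3.1, h3.2, h4.1, h4.2]
    have h6 : |(1 - 2 * φ p.1 - φ p.2) - (1 - 2 * φ q.1 - φ q.2)|
        ≤ 3 * Real.exp m * dist p q := by
      rw [abs_le]; constructor <;> linarith [h3.1, h3.2, h4.1, h4.2]
    have h7 : 0 ≤ 3 * Real.exp m * dist p q := by positivity
    rw [Prod.dist_eq, Real.dist_eq, Real.dist_eq]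
    refine max_le ?_ ?_
    · simp only [hG]
      rw [← mul_sub, abs_mul, abs_of_pos hμ']
      nlinarith [mul_le_mul_of_nonneg_left h5 hμ'.le]
    · refine h6.trans ?_
      nlinarith [mul_nonneg hμ'.le h7]
  have hL : ∀ p, ‖G p‖ ≤ ((1/μ + 1) * (1 + 3 * Real.exp m)).toNNReal := by
    intro p
    rw [Real.coe_toNNReal _ (by positivity), Prod.norm_def, Real.norm_eq_abs, Real.norm_eq_abs]
    have h1 := hφ0 p.1
    have h2 := hφ0 p.2
    have h3 := hφm p.1
    have h4 := hφm p.2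
    have h5 : |1 - φ p.1 - 2 * φ p.2| ≤ 1 + 3 * Real.exp m := by
      rw [abs_le]; constructor <;> linarith
    have h6 : |1 - 2 * φ p.1 - φ p.2| ≤ 1 + 3 * Real.exp m := by
      rw [abs_le]; constructor <;> linarith
    refine max_le ?_ ?_
    · simp only [hG]
      rw [abs_mul, abs_of_pos hμ']
      nlinarith [mul_le_mul_of_nonneg_left h5 hμ'.le]
    · refine h6.trans ?_
      nlinarith [mul_pos hμ' (by positivity : 0 < 1 + 3 * Real.exp m)]
  obtain ⟨α, hα0, hα⟩ :=
    exists_hasDerivWithinAt_of_bounded_lipschitz hK hL hab (Real.log z0, Real.log y0)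
  have hu : ∀ t ∈ Icc a b, HasDerivWithinAt (fun t => (α t).1) (G (α t)).1 (Icc a b) t :=
    fun t ht => (hasFDerivAt_fst (p := α t)).comp_hasDerivWithinAt t (hα t ht)
  have hv : ∀ t ∈ Icc a b, HasDerivWithinAt (fun t => (α t).2) (G (α t)).2 (Icc a b) t :=
    fun t ht => (hasFDerivAt_snd (p := α t)).comp_hasDerivWithinAt t (hα t ht)
  have hαc : ContinuousOn α (Icc a b) := fun t ht => (hα t ht).continuousWithinAt
  have hum : ∀ t ∈ Icc a b, (α t).1 ≤ m := by
    refine le_const_of_deriv_neg (f' := fun t => (G (α t)).1) (by fun_prop) (by fun_prop)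
      (fun t ht => (hu t (Ioo_subset_Icc_self ht)).hasDerivAt (Icc_mem_nhds ht.1 ht.2))
      (by rw [hα0]; exact hzm) (fun t ht h => ?_)
    refine mul_neg_of_pos_of_neg hμ' ?_
    have := hφ0 (α t).2
    rw [h]
    linarith
  have hvm : ∀ t ∈ Icc a b, (α t).2 ≤ m := by
    refine le_const_of_deriv_neg (f' := fun t => (G (α t)).2) (by fun_prop) (by fun_prop)
      (fun t ht => (hv t (Ioo_subset_Icc_self ht)).hasDerivAt (Icc_mem_nhds ht.1 ht.2))
      (by rw [hα0]; exact hym) (fun t ht h => ?_)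
    have := hφ0 (α t).1
    simp only [hG, h]
    linarith
  refine ⟨fun t => Real.exp (α t).1, fun t => Real.exp (α t).2, ?_, ?_,
    fun t _ => ⟨Real.exp_pos _, Real.exp_pos _⟩, fun t ht => ?_⟩
  · simp [hα0, Real.exp_log hz0]
  · simp [hα0, Real.exp_log hy0]
  · have h1 : φ (α t).1 = Real.exp (α t).1 := by simp [hφ, hum t ht]
    have h2 : φ (α t).2 = Real.exp (α t).2 := by simp [hφ, hvm t ht]
    refine ⟨(hu t ht).exp.congr_deriv ?_, (hv t ht).exp.congr_deriv ?_⟩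
    · simp only [hG, h1, h2]
      ring
    · simp only [hG, h1, h2]

/-! ### The grid of impulse moments -/

/-- The index of the interval `(j/3, (j+1)/3]` containing `t` (and `0` for `t ≤ 0`). -/
def gridIndex (t : ℝ) : ℕ := ⌈3 * t⌉₊ - 1

lemma gridIndex_zero : gridIndex 0 = 0 := by simp [gridIndex]

lemma gridIndex_eq {j : ℕ} {t : ℝ} (ht : t ∈ Ioc ((j:ℝ)/3) (((j:ℝ)+1)/3)) :
    gridIndex t = j := by
  have h : ⌈3 * t⌉₊ = j + 1 := by
    rw [Nat.ceil_eq_iff (by omega)]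
    push_cast
    constructor <;> linarith [ht.1, ht.2]
  rw [gridIndex, h, Nat.add_sub_cancel]

lemma mem_Ioc_gridIndex {t : ℝ} (ht : 0 < t) :
    t ∈ Ioc ((gridIndex t : ℝ)/3) (((gridIndex t : ℝ)+1)/3) := by
  obtain ⟨n, hn⟩ : ∃ n, ⌈3 * t⌉₊ = n + 1 :=
    Nat.exists_eq_succ_of_ne_zero (Nat.ceil_pos.2 (by positivity)).ne'
  have h := (Nat.ceil_eq_iff (by omega)).1 hn
  have hj : gridIndex t = n := by rw [gridIndex, hn, Nat.add_sub_cancel]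
  push_cast at h
  rw [hj]
  constructor <;> linarith [h.1, h.2]

lemma gridIndex_le_five {t : ℝ} (h0 : 0 < t) (h2 : t ≤ 2) : gridIndex t ≤ 5 := by
  have h := (mem_Ioc_gridIndex h0).1
  have : (gridIndex t : ℝ) < 6 := by linarith
  have : gridIndex t < 6 := by exact_mod_cast this
  omega

lemma ne_grid_of_mem_Ioo {j : ℕ} {t : ℝ} (ht : t ∈ Ioo ((j:ℝ)/3) (((j:ℝ)+1)/3)) (i : ℕ) :
    t ≠ (i:ℝ)/3 := by
  rintro rfl
  have h1 : (j:ℝ) < i := by linarith [ht.1]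
  have h2 : (i:ℝ) < j + 1 := by linarith [ht.2]
  have h3 : j < i := by exact_mod_cast h1
  have h4 : i < j + 1 := by exact_mod_cast h2
  omega

lemma Icc_grid_subset {j : ℕ} (hj : j ≤ 5) :
    Icc ((j:ℝ)/3) (((j:ℝ)+1)/3) ⊆ Icc 0 2 := by
  have : (j:ℝ) ≤ 5 := by exact_mod_cast hj
  exact Icc_subset_Icc (by positivity) (by linarith)

/-- Away from the impulse moments the grid index is locally constant on `[0,2]`. -/
lemma eventually_gridIndex_eq {t : ℝ} (ht : t ∈ Icc (0:ℝ) 2)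
    (hne : ∀ i ∈ Finset.Icc (1:ℕ) 5, t ≠ (i:ℝ)/3) :
    ∀ᶠ s in 𝓝[Icc (0:ℝ) 2] t,
      s ∈ Icc ((gridIndex t : ℝ)/3) (((gridIndex t : ℝ)+1)/3) ∧ gridIndex s = gridIndex t := by
  rcases eq_or_lt_of_le ht.1 with rfl | h0
  · filter_upwards [self_mem_nhdsWithin,
      mem_nhdsWithin_of_mem_nhds (Iio_mem_nhds (by norm_num : (0:ℝ) < 1/3))] with s hs hs'
    rw [mem_Iio] at hs'
    simp only [gridIndex_zero]
    refine ⟨⟨by simpa using hs.1, by norm_num; linarith⟩, ?_⟩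
    rcases eq_or_lt_of_le hs.1 with rfl | hs0
    · exact gridIndex_zero
    · exact gridIndex_eq ⟨by simpa using hs0, by norm_num; linarith⟩
  · have hm := mem_Ioc_gridIndex h0
    have h5 := gridIndex_le_five h0 ht.2
    have key : ∀ᶠ s in 𝓝[Icc (0:ℝ) 2] t, s ≤ ((gridIndex t : ℝ)+1)/3 := by
      rcases Nat.lt_or_ge (gridIndex t) 5 with hlt | hge
      · have hne' := hne (gridIndex t + 1) (Finset.mem_Icc.2 ⟨by omega, by omega⟩)
        push_cast at hne'
        filter_upwards [mem_nhdsWithin_of_mem_nhds (Iio_mem_nhds (lt_of_le_of_ne hm.2 hne'))]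
          with s hs using le_of_lt hs
      · have h : gridIndex t = 5 := le_antisymm h5 hge
        filter_upwards [self_mem_nhdsWithin] with s hs
        rw [h]
        norm_num
        exact hs.2
    filter_upwards [key, mem_nhdsWithin_of_mem_nhds (Ioi_mem_nhds hm.1)] with s hs1 hs2
    exact ⟨⟨le_of_lt hs2, hs1⟩, gridIndex_eq ⟨hs2, hs1⟩⟩

/-- Concatenation of functions given on the successive intervals of the grid. -/
def glue (g : ℕ → ℝ → ℝ) (t : ℝ) : ℝ := g (gridIndex t) t

lemma glue_eq (g : ℕ → ℝ → ℝ) {j : ℕ} {t : ℝ} (ht : t ∈ Ioc ((j:ℝ)/3) (((j:ℝ)+1)/3)) :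
    glue g t = g j t := by
  rw [glue, gridIndex_eq ht]

lemma grid_lt_succ (j : ℕ) : (j:ℝ)/3 < ((j:ℝ)+1)/3 := by linarith

lemma hasDerivWithinAt_glue {g : ℕ → ℝ → ℝ} {t D : ℝ} (ht : t ∈ Icc (0:ℝ) 2)
    (hne : ∀ i ∈ Finset.Icc (1:ℕ) 5, t ≠ (i:ℝ)/3)
    (hD : HasDerivWithinAt (g (gridIndex t)) D
      (Icc ((gridIndex t : ℝ)/3) (((gridIndex t : ℝ)+1)/3)) t) :
    HasDerivWithinAt (glue g) D (Icc (0:ℝ) 2) t := by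
  have hev := eventually_gridIndex_eq ht hne
  refine ((hD.mono fun s hs => hs.1).congr (f₁ := glue g) (s := {s | s ∈ Icc ((gridIndex t : ℝ)/3)
    (((gridIndex t : ℝ)+1)/3) ∧ gridIndex s = gridIndex t}) (fun s hs => ?_)
      rfl).mono_of_mem_nhdsWithin hev
  rw [glue, hs.2]

lemma tendsto_glue_left {g : ℕ → ℝ → ℝ} {j : ℕ}
    (hg : ContinuousOn (g j) (Icc ((j:ℝ)/3) (((j:ℝ)+1)/3))) :
    Tendsto (glue g) (𝓝[<] (((j:ℝ)+1)/3)) (𝓝 (g j (((j:ℝ)+1)/3))) := by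
  have hI : Ioo ((j:ℝ)/3) (((j:ℝ)+1)/3) ∈ 𝓝[<] (((j:ℝ)+1)/3) :=
    Ioo_mem_nhdsLT (grid_lt_succ j)
  have h : Tendsto (g j) (𝓝[<] (((j:ℝ)+1)/3)) (𝓝 (g j (((j:ℝ)+1)/3))) :=
    (hg _ (right_mem_Icc.2 (grid_lt_succ j).le)).mono_left <|
      nhdsWithin_le_iff.2 (mem_of_superset hI Ioo_subset_Icc_self)
  refine h.congr' ?_
  filter_upwards [hI] with s hs using (glue_eq g (Ioo_subset_Ioc_self hs)).symm

lemma tendsto_glue_right {g : ℕ → ℝ → ℝ} {j : ℕ}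
    (hg : ContinuousOn (g j) (Icc ((j:ℝ)/3) (((j:ℝ)+1)/3))) :
    Tendsto (glue g) (𝓝[>] ((j:ℝ)/3)) (𝓝 (g j ((j:ℝ)/3))) := by
  have hI : Ioo ((j:ℝ)/3) (((j:ℝ)+1)/3) ∈ 𝓝[>] ((j:ℝ)/3) :=
    Ioo_mem_nhdsGT (grid_lt_succ j)
  have h : Tendsto (g j) (𝓝[>] ((j:ℝ)/3)) (𝓝 (g j ((j:ℝ)/3))) :=
    (hg _ (left_mem_Icc.2 (grid_lt_succ j).le)).mono_left <|
      nhdsWithin_le_iff.2 (mem_of_superset hI Ioo_subset_Icc_self)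
  refine h.congr' ?_
  filter_upwards [hI] with s hs using (glue_eq g (Ioo_subset_Ioc_self hs)).symm

/-! ### Existence for the impulsive problem -/

lemma exists_pieces {μ : ℝ} (hμ : 0 < μ) :
    ∃ z y : ℕ → ℝ → ℝ, z 0 0 = 1 ∧ y 0 0 = 2 ∧
      (∀ j : ℕ, z (j+1) (((j:ℝ)+1)/3) = z j (((j:ℝ)+1)/3)) ∧
      (∀ j : ℕ, y (j+1) (((j:ℝ)+1)/3) = y j (((j:ℝ)+1)/3) ^ 2 + z j (((j:ℝ)+1)/3)) ∧
      ∀ j : ℕ, ∀ t ∈ Icc ((j:ℝ)/3) (((j:ℝ)+1)/3),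
        HasDerivWithinAt (z j) ((1/μ) * (z j t * (1 - z j t - 2 * y j t)))
          (Icc ((j:ℝ)/3) (((j:ℝ)+1)/3)) t ∧
        HasDerivWithinAt (y j) (y j t * (1 - 2 * z j t - y j t))
          (Icc ((j:ℝ)/3) (((j:ℝ)+1)/3)) t := by
  have H : ∀ (j : ℕ) (p : {p : ℝ × ℝ // 0 < p.1 ∧ 0 < p.2}), ∃ s : (ℝ → ℝ) × (ℝ → ℝ),
      s.1 ((j:ℝ)/3) = p.1.1 ∧ s.2 ((j:ℝ)/3) = p.1.2 ∧
      (∀ t ∈ Icc ((j:ℝ)/3) (((j:ℝ)+1)/3), 0 < s.1 t ∧ 0 < s.2 t) ∧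
      ∀ t ∈ Icc ((j:ℝ)/3) (((j:ℝ)+1)/3),
        HasDerivWithinAt s.1 ((1/μ) * (s.1 t * (1 - s.1 t - 2 * s.2 t)))
          (Icc ((j:ℝ)/3) (((j:ℝ)+1)/3)) t ∧
        HasDerivWithinAt s.2 (s.2 t * (1 - 2 * s.1 t - s.2 t))
          (Icc ((j:ℝ)/3) (((j:ℝ)+1)/3)) t := by
    intro j p
    obtain ⟨z, y, h⟩ := exists_smooth_solution (grid_lt_succ j).le p.2.1 p.2.2 hμ
    exact ⟨(z, y), h⟩
  choose S hSz hSy hSpos hSd using H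
  let next : (j : ℕ) → {p : ℝ × ℝ // 0 < p.1 ∧ 0 < p.2} → {p : ℝ × ℝ // 0 < p.1 ∧ 0 < p.2} :=
    fun j p => ⟨((S j p).1 (((j:ℝ)+1)/3),
      (S j p).2 (((j:ℝ)+1)/3) ^ 2 + (S j p).1 (((j:ℝ)+1)/3)), by
        have h := hSpos j p _ (right_mem_Icc.2 (grid_lt_succ j).le)
        exact ⟨h.1, by have := h.1; positivity⟩⟩
  let p : ℕ → {p : ℝ × ℝ // 0 < p.1 ∧ 0 < p.2} :=
    fun n => Nat.rec ⟨(1, 2), by norm_num⟩ next n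
  refine ⟨fun j => (S j (p j)).1, fun j => (S j (p j)).2, ?_, ?_, fun j => ?_, fun j => ?_,
    fun j => hSd j (p j)⟩
  · simpa [p] using hSz 0 (p 0)
  · simpa [p] using hSy 0 (p 0)
  · simpa using hSz (j+1) (p (j+1))
  · simpa using hSy (j+1) (p (j+1))

lemma exists_isSlowFastSol {μ : ℝ} (hμ : 0 < μ) :
    ∃ z y : ℝ → ℝ, IsSlowFastSol 2 5 (fun j => (j:ℝ)/3)
      (fun z y => z * (1 - z - 2*y)) (fun z y => y * (1 - 2*z - y))
      (fun z y => y^2 - y + z) μ 1 2 z y := by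
  obtain ⟨z, y, hz0, hy0, hzs, hys, hd⟩ := exists_pieces hμ
  have hcz : ∀ j : ℕ, ContinuousOn (z j) (Icc ((j:ℝ)/3) (((j:ℝ)+1)/3)) :=
    fun j t ht => (hd j t ht).1.continuousWithinAt
  have hcy : ∀ j : ℕ, ContinuousOn (y j) (Icc ((j:ℝ)/3) (((j:ℝ)+1)/3)) :=
    fun j t ht => (hd j t ht).2.continuousWithinAt
  have hval : ∀ (g : ℕ → ℝ → ℝ) (j : ℕ), glue g (((j:ℝ)+1)/3) = g j (((j:ℝ)+1)/3) :=
    fun g j => glue_eq g (right_mem_Ioc.2 (grid_lt_succ j))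
  have hmain : ∀ t ∈ Icc (0:ℝ) 2, (∀ j ∈ Finset.Icc (1:ℕ) 5, t ≠ (j:ℝ)/3) →
      HasDerivWithinAt (glue z) ((1/μ) * (glue z t * (1 - glue z t - 2 * glue y t)))
        (Icc (0:ℝ) 2) t ∧
      HasDerivWithinAt (glue y) (glue y t * (1 - 2 * glue z t - glue y t))
        (Icc (0:ℝ) 2) t := by
    intro t ht hne
    have hm := ((eventually_gridIndex_eq ht hne).self_of_nhdsWithin ht).1
    exact ⟨hasDerivWithinAt_glue ht hne (hd _ t hm).1,
      hasDerivWithinAt_glue ht hne (hd _ t hm).2⟩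
  refine ⟨glue z, glue y, ?_, ?_, ?_, ?_, ?_, ?_, ?_⟩
  · rw [glue, gridIndex_zero, hz0]
  · rw [glue, gridIndex_zero, hy0]
  · intro t ht
    by_cases hne : ∀ j ∈ Finset.Icc (1:ℕ) 5, t ≠ (j:ℝ)/3
    · exact (hmain t ht hne).1.continuousWithinAt
    · push Not at hne
      obtain ⟨i, hi, rfl⟩ := hne
      obtain ⟨j, rfl⟩ : ∃ j, i = j + 1 := ⟨i - 1, by have := Finset.mem_Icc.1 hi; omega⟩
      refine ContinuousAt.continuousWithinAt (continuousAt_iff_continuous_left'_right'.2 ⟨?_, ?_⟩)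
      · have h := tendsto_glue_left (hcz j)
        rw [← hval z] at h
        simpa [ContinuousWithinAt] using h
      · have h := tendsto_glue_right (hcz (j+1))
        push_cast at h
        rw [hzs, ← hval z] at h
        simpa [ContinuousWithinAt] using h
  · exact fun t ht hne => (hmain t ht hne).2.continuousWithinAt
  · intro i hi
    obtain ⟨j, rfl⟩ : ∃ j, i = j + 1 := ⟨i - 1, by have := Finset.mem_Icc.1 hi; omega⟩
    have h := tendsto_glue_left (hcy j)
    rw [← hval y] at h
    simpa using h
  · intro i hi
    obtain ⟨j, rfl⟩ : ∃ j, i = j + 1 := ⟨i - 1, by have := Finset.mem_Icc.1 hi; omega⟩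
    have h := tendsto_glue_right (hcy (j+1))
    push_cast at h ⊢
    rw [hys, ← hval y, ← hval z] at h
    convert h using 2
    ring
  · exact fun t ht hne => ⟨(hmain t ht hne).1.mono sdiff_subset,
      (hmain t ht hne).2.mono sdiff_subset⟩

/-! ### Passage to the limit on one interval -/

lemma tendsto_of_isSmoothSol {a b : ℝ} (hab : a < b) {Z Y : ℝ → ℝ → ℝ} {w : ℝ → ℝ}
    (hsol : ∀ᶠ μ in 𝓝[>] (0:ℝ), IsSmoothSol a b μ (Z μ) (Y μ))
    (hw : IsLogisticSol a b w) (hwa : 1 < w a)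
    (hY : Tendsto (fun μ => Y μ a) (𝓝[>] (0:ℝ)) (𝓝 (w a)))
    (hZ : ∀ᶠ μ in 𝓝[>] (0:ℝ), 0 < Z μ a ∧ Z μ a ≤ 1) :
    (∀ t ∈ Ioc a b, Tendsto (fun μ => Y μ t) (𝓝[>] (0:ℝ)) (𝓝 (w t))) ∧
    (∀ t ∈ Ioc a b, Tendsto (fun μ => Z μ t) (𝓝[>] (0:ℝ)) (𝓝 0)) ∧
    ∀ᶠ μ in 𝓝[>] (0:ℝ), 0 < Z μ b ∧ Z μ b ≤ 1 := by
  have hμ0 : Tendsto (fun μ : ℝ => μ) (𝓝[>] (0:ℝ)) (𝓝 0) := tendsto_id.mono_left inf_le_left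
  have hgood : ∀ᶠ μ in 𝓝[>] (0:ℝ), 0 < μ ∧ IsSmoothSol a b μ (Z μ) (Y μ) ∧ 0 < Z μ a ∧
      Z μ a ≤ 1 ∧ 0 < Y μ a ∧ Y μ a ≤ w a + 1 ∧ ∀ t ∈ Icc a b, 4/5 ≤ Y μ t := by
    filter_upwards [self_mem_nhdsWithin, hsol, hZ, hμ0.eventually_le_const
      (by norm_num : (0:ℝ) < 1/20), hY.eventually_const_le (by linarith : 19/20 < w a),
      hY.eventually_le_const (lt_add_one (w a))] with μ h1 h2 h3 h4 h5 h6
    rw [mem_Ioi] at h1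
    refine ⟨h1, h2, h3.1, h3.2, by linarith, h6,
      h2.four_fifths_le h1 h4 h3.1 h3.2 (by linarith) ?_⟩
    nlinarith [h3.1, h3.2]
  refine ⟨fun t ht => ?_, fun t ht => ?_, ?_⟩
  · have hlim : Tendsto (fun μ => (Y μ a - w a) ^ 2 + 10 * (w a + 1) ^ 2 * μ)
        (𝓝[>] (0:ℝ)) (𝓝 0) := by
      simpa using ((hY.sub_const (w a)).pow 2).add (hμ0.const_mul (10 * (w a + 1) ^ 2))
    have hsq : Tendsto (fun μ => (Y μ t - w t) ^ 2) (𝓝[>] (0:ℝ)) (𝓝 0) := by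
      refine squeeze_zero' (Eventually.of_forall fun μ => sq_nonneg _) ?_ hlim
      filter_upwards [hgood] with μ h
      obtain ⟨h1, h2, h3, h4, h5, h6, h7⟩ := h
      have h8 := h2.sq_sub_le hw h1 (by linarith : 1 < w a + 1) h3 h7 h6 hwa
        (lt_add_one (w a)).le t (Ioc_subset_Icc_self ht)
      have h9 : 10 * (w a + 1) ^ 2 * μ * Z μ a ≤ 10 * (w a + 1) ^ 2 * μ :=
        mul_le_of_le_one_right (by positivity) h4
      linarith
    have habs : Tendsto (fun μ => |Y μ t - w t|) (𝓝[>] (0:ℝ)) (𝓝 0) := by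
      simpa [Real.sqrt_sq_eq_abs] using hsq.sqrt
    exact tendsto_sub_nhds_zero_iff.1 ((tendsto_zero_iff_abs_tendsto_zero _).2 habs)
  · have hta : 0 < 3/5 * (t - a) := by linarith [ht.1]
    have hlim : Tendsto (fun μ => μ / (3/5 * (t - a))) (𝓝[>] (0:ℝ)) (𝓝 0) := by
      simpa using hμ0.div_const (3/5 * (t - a))
    refine squeeze_zero' ?_ ?_ hlim
    · filter_upwards [hgood] with μ h
      exact (h.2.1.z_pos h.2.2.1 t (Ioc_subset_Icc_self ht)).le
    · filter_upwards [hgood] with μ h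
      obtain ⟨h1, h2, h3, h4, -, -, h7⟩ := h
      have h8 := h2.z_mul_le h1 h3 h7 t (Ioc_subset_Icc_self ht)
      have h9 := h2.z_pos h3 t (Ioc_subset_Icc_self ht)
      rw [le_div_iff₀ hta]
      nlinarith [mul_pos h9 h1]
  · filter_upwards [hgood] with μ h
    obtain ⟨h1, h2, h3, h4, h5, -, -⟩ := h
    exact ⟨h2.z_pos h3 b (right_mem_Icc.2 hab.le), h2.z_le h1 h4 h5 b (right_mem_Icc.2 hab.le)⟩

/-! ### Restriction of impulsive solutions to the intervals of the grid -/

lemma continuousOn_update_of_tendsto {f : ℝ → ℝ} {a b r : ℝ}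
    (hf : ContinuousOn f (Ioc a b)) (hr : Tendsto f (𝓝[>] a) (𝓝 r)) :
    ContinuousOn (Function.update f a r) (Icc a b) := by
  rw [continuousOn_update_iff]
  refine ⟨hf.mono fun x hx => ⟨lt_of_le_of_ne hx.1.1 (Ne.symm hx.2), hx.1.2⟩, fun _ => ?_⟩
  exact hr.mono_left (nhdsWithin_mono _ fun x hx => lt_of_le_of_ne hx.1.1 (Ne.symm hx.2))

lemma continuousOn_Ioc_grid {f : ℝ → ℝ} {j : ℕ} (hj : j ≤ 5)
    (hc : ∀ t ∈ Icc (0:ℝ) 2, (∀ i ∈ Finset.Icc (1:ℕ) 5, t ≠ (i:ℝ)/3) →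
      ContinuousWithinAt f (Icc (0:ℝ) 2) t)
    (hl : ∀ i ∈ Finset.Icc (1:ℕ) 5, Tendsto f (𝓝[<] ((i:ℝ)/3)) (𝓝 (f ((i:ℝ)/3)))) :
    ContinuousOn f (Ioc ((j:ℝ)/3) (((j:ℝ)+1)/3)) := by
  intro t ht
  have hsub : Ioc ((j:ℝ)/3) (((j:ℝ)+1)/3) ⊆ Icc 0 2 :=
    Ioc_subset_Icc_self.trans (Icc_grid_subset hj)
  rcases eq_or_lt_of_le ht.2 with rfl | hlt
  · rcases Nat.lt_or_ge j 5 with h | h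
    · have h1 := hl (j+1) (Finset.mem_Icc.2 ⟨by omega, by omega⟩)
      push_cast at h1
      have h2 : ContinuousWithinAt f (Iic (((j:ℝ)+1)/3)) (((j:ℝ)+1)/3) :=
        continuousWithinAt_Iio_iff_Iic.1 h1
      exact h2.mono fun x hx => hx.2
    · have h5 : j = 5 := le_antisymm hj h
      subst h5
      refine (hc _ (hsub ht) fun i hi h1 => ?_).mono hsub
      have h2 : (i:ℝ) ≤ 5 := by exact_mod_cast (Finset.mem_Icc.1 hi).2
      norm_num at h1
      linarith
  · exact (hc t (hsub ht) fun i _ => ne_grid_of_mem_Ioo ⟨ht.1, hlt⟩ i).mono hsub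

lemma hasDerivAt_of_mem_Ioo_grid {f : ℝ → ℝ} {D t : ℝ} {j : ℕ} (hj : j ≤ 5)
    (ht : t ∈ Ioo ((j:ℝ)/3) (((j:ℝ)+1)/3))
    (h : HasDerivWithinAt f D
      (Icc (0:ℝ) 2 \ ((fun i : ℕ => (i:ℝ)/3) '' Icc 1 5)) t) : HasDerivAt f D t := by
  refine h.hasDerivAt (mem_of_superset (Ioo_mem_nhds ht.1 ht.2) fun s hs =>
    ⟨Icc_grid_subset hj (Ioo_subset_Icc_self hs), ?_⟩)
  rintro ⟨i, -, rfl⟩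
  exact ne_grid_of_mem_Ioo hs i rfl

lemma hasDerivAt_update_of_lt {f : ℝ → ℝ} {D a r t : ℝ} (hat : a < t) (h : HasDerivAt f D t) :
    HasDerivAt (Function.update f a r) D t := by
  refine h.congr_of_eventuallyEq ?_
  filter_upwards [Ioi_mem_nhds hat] with s hs using Function.update_of_ne (ne_of_gt hs) r f

lemma IsSlowFastSol.isSmoothSol_update {μ z0 y0 r : ℝ} {J : ℝ → ℝ → ℝ} {z y : ℝ → ℝ}
    (h : IsSlowFastSol 2 5 (fun j => (j:ℝ)/3)
      (fun z y => z * (1 - z - 2*y)) (fun z y => y * (1 - 2*z - y)) J μ z0 y0 z y)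
    {j : ℕ} (hj : j ≤ 5) (hr : Tendsto y (𝓝[>] ((j:ℝ)/3)) (𝓝 r)) :
    IsSmoothSol ((j:ℝ)/3) (((j:ℝ)+1)/3) μ z (Function.update y ((j:ℝ)/3) r) := by
  obtain ⟨-, -, hz, hy, hl, -, hd⟩ := h
  have hd' : ∀ t ∈ Ioo ((j:ℝ)/3) (((j:ℝ)+1)/3),
      HasDerivAt z ((1/μ) * (z t * (1 - z t - 2 * y t))) t ∧
      HasDerivAt y (y t * (1 - 2 * z t - y t)) t := fun t ht => by
    have h := hd t (Icc_grid_subset hj (Ioo_subset_Icc_self ht))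
      fun i _ => ne_grid_of_mem_Ioo ht i
    exact ⟨hasDerivAt_of_mem_Ioo_grid hj ht h.1, hasDerivAt_of_mem_Ioo_grid hj ht h.2⟩
  refine ⟨fun t ht => (hz t (Icc_grid_subset hj ht)).mono (Icc_grid_subset hj),
    continuousOn_update_of_tendsto (continuousOn_Ioc_grid hj hy hl) hr,
    fun t ht => ?_, fun t ht => ?_⟩
  · rw [Function.update_of_ne (ne_of_gt ht.1)]
    exact (hd' t ht).1
  · rw [Function.update_of_ne (ne_of_gt ht.1)]
    exact hasDerivAt_update_of_lt ht.1 (hd' t ht).2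

lemma IsDegenSol1.isLogisticSol_update {y0 r : ℝ} {Jb : ℝ → ℝ} {w : ℝ → ℝ}
    (h : IsDegenSol1 2 5 (fun j => (j:ℝ)/3) (fun y => y * (1 - y)) Jb y0 w)
    {j : ℕ} (hj : j ≤ 5) (hr : Tendsto w (𝓝[>] ((j:ℝ)/3)) (𝓝 r)) :
    IsLogisticSol ((j:ℝ)/3) (((j:ℝ)+1)/3) (Function.update w ((j:ℝ)/3) r) := by
  obtain ⟨-, hc, hl, -, hd⟩ := h
  refine ⟨continuousOn_update_of_tendsto (continuousOn_Ioc_grid hj hc hl) hr, fun t ht => ?_⟩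
  rw [Function.update_of_ne (ne_of_gt ht.1)]
  exact hasDerivAt_update_of_lt ht.1 <| hasDerivAt_of_mem_Ioo_grid hj ht <|
    hd t (Icc_grid_subset hj (Ioo_subset_Icc_self ht)) fun i _ => ne_grid_of_mem_Ioo ht i

/-- Right continuity at the left end point, where there is no impulse. -/
lemma tendsto_right_zero {f : ℝ → ℝ}
    (hc : ∀ t ∈ Icc (0:ℝ) 2, (∀ i ∈ Finset.Icc (1:ℕ) 5, t ≠ (i:ℝ)/3) →
      ContinuousWithinAt f (Icc (0:ℝ) 2) t) :
    Tendsto f (𝓝[>] 0) (𝓝 (f 0)) := by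
  refine (hc 0 (by norm_num) fun i hi h => ?_).mono_left (nhdsWithin_le_iff.2
    (mem_of_superset (Ioo_mem_nhdsGT (by norm_num : (0:ℝ) < 2)) Ioo_subset_Icc_self))
  have h1 : (1:ℝ) ≤ i := by exact_mod_cast (Finset.mem_Icc.1 hi).1
  linarith

/-! ### Passage to the limit for the impulsive problem -/

section Limit

variable {ybar : ℝ → ℝ} {Z Y : ℝ → ℝ → ℝ}

/-- Convergence on the interval `(j/3, (j+1)/3]`, given convergence of the right limits at `j/3`. -/
lemma tendsto_on_grid_interval
    (hybar : IsDegenSol1 2 5 (fun j => (j:ℝ)/3)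
      (fun y => y * (1 - y)) (fun y => y^2 - y) 2 ybar)
    (hsol : ∀ᶠ μ in 𝓝[>] (0:ℝ), IsSlowFastSol 2 5 (fun j => (j:ℝ)/3)
      (fun z y => z * (1 - z - 2*y)) (fun z y => y * (1 - 2*z - y))
      (fun z y => y^2 - y + z) μ 1 2 (Z μ) (Y μ))
    {j : ℕ} (hj : j ≤ 5) {R : ℝ → ℝ} {r : ℝ}
    (hR : ∀ᶠ μ in 𝓝[>] (0:ℝ), Tendsto (Y μ) (𝓝[>] ((j:ℝ)/3)) (𝓝 (R μ)))
    (hr : Tendsto ybar (𝓝[>] ((j:ℝ)/3)) (𝓝 r)) (hr1 : 1 < r)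
    (hRr : Tendsto R (𝓝[>] (0:ℝ)) (𝓝 r))
    (hZ : ∀ᶠ μ in 𝓝[>] (0:ℝ), 0 < Z μ ((j:ℝ)/3) ∧ Z μ ((j:ℝ)/3) ≤ 1) :
    (∀ t ∈ Ioc ((j:ℝ)/3) (((j:ℝ)+1)/3),
      Tendsto (fun μ => Y μ t) (𝓝[>] (0:ℝ)) (𝓝 (ybar t)) ∧
      Tendsto (fun μ => Z μ t) (𝓝[>] (0:ℝ)) (𝓝 0) ∧ 1 < ybar t) ∧
    ∀ᶠ μ in 𝓝[>] (0:ℝ), 0 < Z μ (((j:ℝ)+1)/3) ∧ Z μ (((j:ℝ)+1)/3) ≤ 1 := by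
  have hw := hybar.isLogisticSol_update hj hr
  have hs : ∀ᶠ μ in 𝓝[>] (0:ℝ), IsSmoothSol ((j:ℝ)/3) (((j:ℝ)+1)/3) μ (Z μ)
      (Function.update (Y μ) ((j:ℝ)/3) (R μ)) := by
    filter_upwards [hsol, hR] with μ h1 h2 using h1.isSmoothSol_update hj h2
  obtain ⟨h1, h2, h3⟩ := tendsto_of_isSmoothSol (grid_lt_succ j) hs hw (by simpa using hr1)
    (by simpa using hRr) hZ
  refine ⟨fun t ht => ⟨?_, h2 t ht, ?_⟩, h3⟩
  · simpa [Function.update_of_ne (ne_of_gt ht.1)] using h1 t ht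
  · simpa [Function.update_of_ne (ne_of_gt ht.1)] using
      hw.one_lt (by simpa using hr1) t (Ioc_subset_Icc_self ht)

/-- At every grid point the right limits of the slow variables converge. -/
lemma exists_tendsto_right_limits
    (hybar : IsDegenSol1 2 5 (fun j => (j:ℝ)/3)
      (fun y => y * (1 - y)) (fun y => y^2 - y) 2 ybar)
    (hsol : ∀ᶠ μ in 𝓝[>] (0:ℝ), IsSlowFastSol 2 5 (fun j => (j:ℝ)/3)
      (fun z y => z * (1 - z - 2*y)) (fun z y => y * (1 - 2*z - y))
      (fun z y => y^2 - y + z) μ 1 2 (Z μ) (Y μ)) (j : ℕ) (hj : j ≤ 5) :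
    ∃ (R : ℝ → ℝ) (r : ℝ),
      (∀ᶠ μ in 𝓝[>] (0:ℝ), Tendsto (Y μ) (𝓝[>] ((j:ℝ)/3)) (𝓝 (R μ))) ∧
      Tendsto ybar (𝓝[>] ((j:ℝ)/3)) (𝓝 r) ∧ 1 < r ∧ Tendsto R (𝓝[>] (0:ℝ)) (𝓝 r) ∧
      ∀ᶠ μ in 𝓝[>] (0:ℝ), 0 < Z μ ((j:ℝ)/3) ∧ Z μ ((j:ℝ)/3) ≤ 1 := by
  induction j with
  | zero =>
    refine ⟨fun _ => 2, 2, ?_, ?_, by norm_num, tendsto_const_nhds, ?_⟩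
    · filter_upwards [hsol] with μ h
      simpa [h.2.1] using tendsto_right_zero h.2.2.2.1
    · simpa [hybar.1] using tendsto_right_zero hybar.2.1
    · filter_upwards [hsol] with μ h
      simp [h.1]
  | succ j ih =>
    obtain ⟨R, r, h1, h2, h3, h4, h5⟩ := ih (by omega)
    obtain ⟨hlim, hZ⟩ := tendsto_on_grid_interval hybar hsol (by omega) h1 h2 h3 h4 h5
    obtain ⟨hYb, hZb, hgt⟩ := hlim _ (right_mem_Ioc.2 (grid_lt_succ j))
    have hmem : j + 1 ∈ Finset.Icc (1:ℕ) 5 := Finset.mem_Icc.2 ⟨by omega, hj⟩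
    push_cast
    refine ⟨fun μ => Y μ (((j:ℝ)+1)/3) ^ 2 + Z μ (((j:ℝ)+1)/3), ybar (((j:ℝ)+1)/3) ^ 2,
      ?_, ?_, by nlinarith, ?_, hZ⟩
    · filter_upwards [hsol] with μ h
      have h6 := h.2.2.2.2.2.1 (j+1) hmem
      push_cast at h6
      convert h6 using 2
      ring
    · have h6 := hybar.2.2.2.1 (j+1) hmem
      push_cast at h6
      convert h6 using 2
      ring
    · simpa using (hYb.pow 2).add hZb

lemma tendsto_of_isSlowFastSol
    (hybar : IsDegenSol1 2 5 (fun j => (j:ℝ)/3)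
      (fun y => y * (1 - y)) (fun y => y^2 - y) 2 ybar)
    (hsol : ∀ᶠ μ in 𝓝[>] (0:ℝ), IsSlowFastSol 2 5 (fun j => (j:ℝ)/3)
      (fun z y => z * (1 - z - 2*y)) (fun z y => y * (1 - 2*z - y))
      (fun z y => y^2 - y + z) μ 1 2 (Z μ) (Y μ)) {t : ℝ} (ht : t ∈ Ioc (0:ℝ) 2) :
    Tendsto (fun μ => Y μ t) (𝓝[>] (0:ℝ)) (𝓝 (ybar t)) ∧
    Tendsto (fun μ => Z μ t) (𝓝[>] (0:ℝ)) (𝓝 0) := by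
  have hj := gridIndex_le_five ht.1 ht.2
  obtain ⟨R, r, h1, h2, h3, h4, h5⟩ := exists_tendsto_right_limits hybar hsol _ hj
  have h := (tendsto_on_grid_interval hybar hsol hj h1 h2 h3 h4 h5).1 t (mem_Ioc_gridIndex ht.1)
  exact ⟨h.1, h.2.1⟩

end Limit

/-- Example for the lemma: the system `μ z' = z(1 − z − 2y)`,
`y' = y(1 − 2z − y)`, `Δy|_{t=η j} = y² − y + z`, `η j = j/3`, `j = 1,…,5`,
`T = 2`, `z(0,μ) = 1`, `y(0,μ) = 2`.  If `ȳ` is the unique solution of the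
degenerate problem `ȳ' = ȳ(1 − ȳ)`, `Δȳ|_{t=η j} = ȳ² − ȳ`, `ȳ(0) = 2`
(obtained from the root `z = 0`), then for all sufficiently small `μ > 0` the
solution `(z(t,μ), y(t,μ))` exists on `[0,2]` and `y(t,μ) → ȳ(t)` for every
`t ∈ [0,2]`, while `z(t,μ) → 0` for every `t ∈ (0,2]`, as `μ → 0+`. -/
theorem example_slow_fast_lemma
    (ybar : ℝ → ℝ)
    (hybar : IsDegenSol1 2 5 (fun j => (j:ℝ)/3)
      (fun y => y * (1 - y)) (fun y => y^2 - y) 2 ybar)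
    (hybaruniq : ∀ w : ℝ → ℝ, IsDegenSol1 2 5 (fun j => (j:ℝ)/3)
      (fun y => y * (1 - y)) (fun y => y^2 - y) 2 w →
      ∀ t ∈ Icc (0:ℝ) 2, w t = ybar t) :
    ∃ μ₀ > (0:ℝ),
      (∀ μ ∈ Ioc (0:ℝ) μ₀, ∃ z y : ℝ → ℝ,
        IsSlowFastSol 2 5 (fun j => (j:ℝ)/3)
          (fun z y => z * (1 - z - 2*y)) (fun z y => y * (1 - 2*z - y))
          (fun z y => y^2 - y + z) μ 1 2 z y) ∧
      ∀ Z Y : ℝ → ℝ → ℝ,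
        (∀ μ ∈ Ioc (0:ℝ) μ₀,
          IsSlowFastSol 2 5 (fun j => (j:ℝ)/3)
            (fun z y => z * (1 - z - 2*y)) (fun z y => y * (1 - 2*z - y))
            (fun z y => y^2 - y + z) μ 1 2 (Z μ) (Y μ)) →
        (∀ t ∈ Icc (0:ℝ) 2,
          Tendsto (fun μ => Y μ t) (𝓝[>] (0:ℝ)) (𝓝 (ybar t))) ∧
        (∀ t ∈ Ioc (0:ℝ) 2,
          Tendsto (fun μ => Z μ t) (𝓝[>] (0:ℝ)) (𝓝 0)) := by
  have hsub : ∀ {P : ℝ → Prop}, (∀ μ ∈ Ioc (0:ℝ) 1, P μ) → ∀ᶠ μ in 𝓝[>] (0:ℝ), P μ :=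
    fun hP => mem_of_superset (Ioc_mem_nhdsGT one_pos) hP
  refine ⟨1, one_pos, fun μ hμ => exists_isSlowFastSol hμ.1, fun Z Y hZY => ?_⟩
  have hsol := hsub hZY
  refine ⟨fun t ht => ?_, fun t ht => (tendsto_of_isSlowFastSol hybar hsol ht).2⟩
  rcases eq_or_lt_of_le ht.1 with rfl | h0
  · refine tendsto_const_nhds.congr' ?_
    filter_upwards [hsol] with μ h
    rw [h.2.1, hybar.1]
  · exact (tendsto_of_isSlowFastSol hybar hsol ⟨h0, ht.2⟩).1
end
end
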